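/- arXiv:1804.09417 — 2 statements merged into one kernel-verified Lean document; each statement's English description precedes it below -/
import Mathlib

section
/- Let (ℙ^{s,η})_{(s,η)∈ℝ₊×Ω} be a path-dependent canonical class. For every s ∈ ℝ₊ define P_s : B_b(Ω) → B_b(Ω) by P_s[φ](η) := E^{s,η}[φ] (the expectation of φ under ℙ^{s,η}). Then (P_s)_{s∈ℝ₊} is a path-dependent system of projectors. -/
open MeasureTheory Filter Topology Set
open scoped NNReal ENNReal

noncomputable section

/-- A function indexed by `ℝ≥0` is *cadlag* if it is right-continuous and has
left limits at every positive time. -/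
def IsCadlag {X : Type*} [TopologicalSpace X] (f : ℝ≥0 → X) : Prop :=
  (∀ t : ℝ≥0, Tendsto f (𝓝[Set.Ici t] t) (𝓝 (f t))) ∧
    ∀ t : ℝ≥0, 0 < t → ∃ l : X, Tendsto f (𝓝[Set.Iio t] t) (𝓝 l)

variable (E : Type*) [TopologicalSpace E] [MeasurableSpace E]

/-- The canonical path space `Ω = D(ℝ₊, E)` of cadlag paths with values in `E`. -/
def PathOmega := {f : ℝ≥0 → E // IsCadlag f}

/-- The canonical σ-field `𝓕 = σ(X_r ; r ≥ 0)` on the path space. -/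
instance instPathOmegaMS : MeasurableSpace (PathOmega E) :=
  ⨆ r : ℝ≥0, MeasurableSpace.comap (fun ω : PathOmega E => ω.1 r) inferInstance

/-- The initial filtration `𝓕^o_t = σ(X_r ; r ≤ t)`. -/
def Fot (t : ℝ≥0) : MeasurableSpace (PathOmega E) :=
  ⨆ r ∈ Set.Iic t, MeasurableSpace.comap (fun ω : PathOmega E => ω.1 r) inferInstance

/-- The canonical (right-continuous) filtration `𝓕_t = ⋂_{s > t} 𝓕^o_s`. -/
def Ft (t : ℝ≥0) : MeasurableSpace (PathOmega E) :=
  ⨅ u ∈ Set.Ioi t, Fot E u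

variable {E}

/-- A *path-dependent canonical class*. -/
structure IsPathCanonicalClass (P : ℝ≥0 → PathOmega E → Measure (PathOmega E)) : Prop where
  isProb : ∀ s η, IsProbabilityMeasure (P s η)
  starts : ∀ (s : ℝ≥0) (η : PathOmega E), P s η {ω | ∀ r ≤ s, ω.1 r = η.1 r} = 1
  fos_meas : ∀ (s : ℝ≥0) (F : Set (PathOmega E)), MeasurableSet F →
    Measurable[Fot E s] fun η => P s η F
  cond : ∀ (s : ℝ≥0) (η : PathOmega E) (t : ℝ≥0), s ≤ t →
    ∀ F : Set (PathOmega E), MeasurableSet F →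
      ∀ G : Set (PathOmega E), MeasurableSet[Fot E t] G →
        ∫⁻ ω in G, P t ω F ∂(P s η) = P s η (F ∩ G)

variable (E)


/-- `B_b(Ω)`: bounded measurable real functions on the path space. -/
def BB (f : PathOmega E → ℝ) : Prop :=
  Measurable f ∧ ∃ C : ℝ, ∀ ω, |f ω| ≤ C

/-- `B^s_b(Ω)`: bounded `𝓕^o_s`-measurable real functions on the path space. -/
def BBs (s : ℝ≥0) (f : PathOmega E → ℝ) : Prop :=
  Measurable[Fot E s] f ∧ ∃ C : ℝ, ∀ ω, |f ω| ≤ C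

/-- A *path-dependent system of projectors*: a family of positivity preserving,
monotonic linear operators on `B_b(Ω)` such that `P_s` is the identity on
`B^s_b(Ω)`, maps `B_b(Ω)` into `B^s_b(Ω)`, and `P_s ∘ P_t = P_s` for `s ≤ t`. -/
structure IsProjSystem (Q : ℝ≥0 → (PathOmega E → ℝ) → PathOmega E → ℝ) : Prop where
  mapsTo : ∀ (s : ℝ≥0) (f : PathOmega E → ℝ), BB E f → BBs E s (Q s f)
  add : ∀ (s : ℝ≥0) (f g : PathOmega E → ℝ), BB E f → BB E g →
    Q s (fun ω => f ω + g ω) = fun ω => Q s f ω + Q s g ω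
  smul : ∀ (s : ℝ≥0) (c : ℝ) (f : PathOmega E → ℝ), BB E f →
    Q s (fun ω => c * f ω) = fun ω => c * Q s f ω
  pos : ∀ (s : ℝ≥0) (f : PathOmega E → ℝ), BB E f → (∀ ω, 0 ≤ f ω) → ∀ ω, 0 ≤ Q s f ω
  monotonic : ∀ (s : ℝ≥0) (f : ℕ → PathOmega E → ℝ) (g : PathOmega E → ℝ),
    (∀ n, BB E (f n)) → BB E g → (∀ ω, Monotone fun n => f n ω) →
    (∀ ω, Tendsto (fun n => f n ω) atTop (𝓝 (g ω))) →
    ∀ ω, Tendsto (fun n => Q s (f n) ω) atTop (𝓝 (Q s g ω))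
  restrict_id : ∀ (s : ℝ≥0) (f : PathOmega E → ℝ), BBs E s f → Q s f = f
  comp : ∀ (s t : ℝ≥0), s ≤ t → ∀ f : PathOmega E → ℝ, BB E f → Q s (Q t f) = Q s f

/-- The operators associated with a family of measures: `P_s[f](η) = E^{s,η}[f]`. -/
def projOf (P : ℝ≥0 → PathOmega E → Measure (PathOmega E)) :
    ℝ≥0 → (PathOmega E → ℝ) → PathOmega E → ℝ :=
  fun s f η => ∫ ω, f ω ∂(P s η)

open ProbabilityTheory

lemma Fot_le (s : ℝ≥0) : Fot E s ≤ instPathOmegaMS E :=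
  iSup₂_le fun r _ =>
    le_iSup (fun r : ℝ≥0 => MeasurableSpace.comap (fun ω : PathOmega E => ω.1 r) inferInstance) r

/-- The σ-field `𝓕^o_s` is generated by the restriction of paths to `[0, s]`. -/
lemma Fot_le_comap_restrict (s : ℝ≥0) :
    Fot E s ≤ MeasurableSpace.comap
      (fun (ω : PathOmega E) (r : Set.Iic s) => ω.1 r) inferInstance := by
  refine iSup₂_le fun r hr => ?_
  rintro _ ⟨A, hA, rfl⟩
  exact ⟨(fun x : Set.Iic s → E => x ⟨r, hr⟩) ⁻¹' A, measurable_pi_apply _ hA, rfl⟩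

variable {E}

lemma Measurable.eq_of_eqOn_Iic {s : ℝ≥0} {f : PathOmega E → ℝ} (hf : Measurable[Fot E s] f)
    {ω η : PathOmega E} (h : ∀ r ≤ s, ω.1 r = η.1 r) : f ω = f η := by
  obtain ⟨A, -, hA⟩ := Fot_le_comap_restrict E s _ (hf (measurableSet_singleton (f η)))
  have hη : η ∈ f ⁻¹' {f η} := rfl
  have hres : (fun r : Set.Iic s => ω.1 r) = fun r : Set.Iic s => η.1 r :=
    funext fun r => h r r.2
  rw [← hA, Set.mem_preimage, ← hres] at hη
  have hω : ω ∈ f ⁻¹' {f η} := hA ▸ hη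
  exact hω

lemma BBs.bb {s : ℝ≥0} {f : PathOmega E → ℝ} (hf : BBs E s f) : BB E f :=
  ⟨hf.1.mono (Fot_le E s) le_rfl, hf.2⟩

lemma BB.integrable {f : PathOmega E → ℝ} (hf : BB E f) (μ : Measure (PathOmega E))
    [IsFiniteMeasure μ] : Integrable f μ :=
  let ⟨C, hC⟩ := hf.2
  Integrable.of_bound hf.1.aestronglyMeasurable C (ae_of_all _ hC)

lemma measurable_integral_of_measurable_coe {α β : Type*} [MeasurableSpace α] [MeasurableSpace β]
    {κ : α → Measure β} (hκ : ∀ a, IsProbabilityMeasure (κ a))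
    (hmeas : ∀ A, MeasurableSet A → Measurable fun a => κ a A) {f : β → ℝ} (hf : Measurable f) :
    Measurable fun a => ∫ y, f y ∂(κ a) := by
  let K : Kernel α β := ⟨κ, Measure.measurable_of_measurable_coe κ hmeas⟩
  have : IsMarkovKernel K := ⟨hκ⟩
  exact (hf.stronglyMeasurable.integral_kernel (κ := K)).measurable

namespace IsPathCanonicalClass

variable {P : ℝ≥0 → PathOmega E → Measure (PathOmega E)}

/-- The kernel `η ↦ ℙ^{s,η}` on the path space. -/
def kernel (hP : IsPathCanonicalClass P) (s : ℝ≥0) : Kernel (PathOmega E) (PathOmega E) :=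
  ⟨P s, Measure.measurable_of_measurable_coe _ fun A hA =>
    (hP.fos_meas s A hA).mono (Fot_le E s) le_rfl⟩

instance (hP : IsPathCanonicalClass P) (s : ℝ≥0) : IsMarkovKernel (hP.kernel s) := ⟨hP.isProb s⟩

lemma kernel_comp (hP : IsPathCanonicalClass P) {s t : ℝ≥0} (hst : s ≤ t) :
    hP.kernel t ∘ₖ hP.kernel s = hP.kernel s := by
  ext η A hA
  rw [Kernel.comp_apply' _ _ _ hA]
  have h := hP.cond s η t hst A hA Set.univ MeasurableSet.univ
  rwa [Measure.restrict_univ, Set.inter_univ] at h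

lemma ae_eq_const (hP : IsPathCanonicalClass P) {s : ℝ≥0} {f : PathOmega E → ℝ}
    (hf : Measurable[Fot E s] f) (η : PathOmega E) : ∀ᵐ ω ∂(P s η), f ω = f η := by
  have := hP.isProb s η
  have hmeas : MeasurableSet {ω | f ω = f η} :=
    hf.mono (Fot_le E s) le_rfl (measurableSet_singleton (f η))
  refine (mem_ae_iff_prob_eq_one hmeas).2 (le_antisymm prob_le_one ((hP.starts s η).ge.trans (measure_mono fun ω hω => ?_)))
  exact hf.eq_of_eqOn_Iic hω

lemma bbs_projOf (hP : IsPathCanonicalClass P) (s : ℝ≥0) {f : PathOmega E → ℝ} (hf : BB E f) :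
    BBs E s (projOf E P s f) := by
  refine ⟨?_, ?_⟩
  · exact @measurable_integral_of_measurable_coe _ _ (Fot E s) _ _ (hP.isProb s)
      (hP.fos_meas s) _ hf.1
  · obtain ⟨C, hC⟩ := hf.2
    refine ⟨C, fun η => ?_⟩
    have := hP.isProb s η
    have h : ∀ᵐ ω ∂(P s η), ‖f ω‖ ≤ C := ae_of_all _ hC
    simpa [projOf] using norm_integral_le_of_norm_le_const h

end IsPathCanonicalClass

variable (E)

/-- Proposition 2.9: the operators `P_s[φ](η) := E^{s,η}[φ]`
associated with a path-dependent canonical class form a path-dependent system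
of projectors. -/
theorem projOf_isProjSystem [PolishSpace E] [BorelSpace E]
    (P : ℝ≥0 → PathOmega E → Measure (PathOmega E))
    (hP : IsPathCanonicalClass P) :
    IsProjSystem E (projOf E P) := by
  have hprob := hP.isProb
  exact
  { mapsTo := fun s f hf => hP.bbs_projOf s hf
    add := fun s f g hf hg => funext fun η => integral_add (hf.integrable _) (hg.integrable _)
    smul := fun s c f _ => funext fun η => integral_const_mul c f
    pos := fun s f _ h0 η => integral_nonneg h0
    monotonic := fun s f g hf hg hmono hlim η =>
      integral_tendsto_of_tendsto_of_monotone (fun n => (hf n).integrable _) (hg.integrable _)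
        (ae_of_all _ hmono) (ae_of_all _ hlim)
    restrict_id := fun s f hf => funext fun η => by
      simp [projOf, integral_congr_ae (hP.ae_eq_const hf.1 η)]
    comp := fun s t hst f hf => funext fun η => by
      have hint : Integrable f ((hP.kernel t ∘ₖ hP.kernel s) η) := hf.integrable _
      have hcomp := Kernel.integral_comp hint
      rw [hP.kernel_comp hst] at hcomp
      exact hcomp.symm }
end
end

section
/- Let (ℙ^{s,η})_{(s,η)∈ℝ₊×Ω} be a path-dependent canonical class satisfying Hypothesis (HAF). Let (A_{t,u})_{(t,u)∈Δ} be a path-dependent AF with bounded variation and L¹ terminal value, with cadlag versions A^{s,η}. Then there exist nondecreasing path-dependent AFs, denoted (Pos(A)_{t,u})_{(t,u)∈Δ} and (Neg(A)_{t,u})_{(t,u)∈Δ}, which for every (s,η) ∈ ℝ₊×Ω admit as cadlag versions under ℙ^{s,η} respectively the positive variation Pos(A^{s,η}) and the negative variation Neg(A^{s,η}) of A^{s,η}. -/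
open MeasureTheory Filter Topology Set
open scoped NNReal ENNReal

noncomputable section

variable (E : Type*) [TopologicalSpace E] [MeasurableSpace E]

variable {E}

variable (E)

/-- The `ℙ`-closure of a sub-σ-field `G`: the σ-field generated by `G` and the
`ℙ`-null sets of the ambient σ-field. -/
def pClosure {Ω : Type*} {m0 : MeasurableSpace Ω} (G : MeasurableSpace Ω)
    (μ : @Measure Ω m0) : MeasurableSpace Ω :=
  G ⊔ MeasurableSpace.generateFrom {s | MeasurableSet[m0] s ∧ μ s = 0}


/-- Hypothesis (H): the conditioning property of the canonical class holds with
respect to the canonical filtration `𝓕_t` (and not only `𝓕^o_t`). -/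
def HypH (P : ℝ≥0 → PathOmega E → Measure (PathOmega E)) : Prop :=
  ∀ (s : ℝ≥0) (η : PathOmega E) (t : ℝ≥0), s ≤ t →
    ∀ F : Set (PathOmega E), MeasurableSet F →
      ∀ G : Set (PathOmega E), MeasurableSet[Ft E t] G →
        ∫⁻ ω in G, P t ω F ∂(P s η) = P s η (F ∩ G)


/-- A process indexed by `ℝ≥0` is `𝓕^o`-progressively measurable. -/
def ProgMeas {β : Type*} [MeasurableSpace β] (X : ℝ≥0 → PathOmega E → β) : Prop :=
  ∀ t : ℝ≥0, Measurable[MeasurableSpace.prod inferInstance (Fot E t)]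
    fun p : Set.Iic t × PathOmega E => X (p.1 : ℝ≥0) p.2

/-- The canonical class is *progressive*: for every measurable `F`, the map
`(t, ω) ↦ ℙ^{t,ω}(F)` is `𝓕^o`-progressively measurable. -/
def ProgressiveClass (P : ℝ≥0 → PathOmega E → Measure (PathOmega E)) : Prop :=
  ∀ F : Set (PathOmega E), MeasurableSet F → ProgMeas E fun t ω => P t ω F


/-- A *path-dependent Additive Functional* with prescribed cadlag versions:
`A t u` is `𝓕^o_u`-measurable for `t ≤ u`, and for every `(s,η)` the process
`Av s η` is a real cadlag `𝓕^{s,η}`-adapted process vanishing on `[0,s]` such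
that `A t u = Av s η u − Av s η t`, `ℙ^{s,η}`-a.s., for all `s ≤ t ≤ u`. -/
structure IsPathAF (P : ℝ≥0 → PathOmega E → Measure (PathOmega E))
    (A : ℝ≥0 → ℝ≥0 → PathOmega E → ℝ)
    (Av : ℝ≥0 → PathOmega E → ℝ≥0 → PathOmega E → ℝ) : Prop where
  meas : ∀ t u : ℝ≥0, t ≤ u → Measurable[Fot E u] (A t u)
  cadlag : ∀ (s : ℝ≥0) (η : PathOmega E) (ω : PathOmega E),
    IsCadlag fun v => Av s η v ω
  vanish : ∀ (s : ℝ≥0) (η : PathOmega E) (v : ℝ≥0) (ω : PathOmega E),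
    v ≤ s → Av s η v ω = 0
  adapted : ∀ (s : ℝ≥0) (η : PathOmega E) (v : ℝ≥0),
    Measurable[pClosure (Ft E v) (P s η)] (Av s η v)
  version : ∀ (s : ℝ≥0) (η : PathOmega E) (t u : ℝ≥0), s ≤ t → t ≤ u →
    ∀ᵐ ω ∂(P s η), A t u ω = Av s η u ω - Av s η t ω

/-- The positive variation of `Y : ℝ≥0 → ℝ` on `[s,t]`: the supremum over finite
subdivisions `s = τ_0 ≤ ⋯ ≤ τ_n = t` of the sums of positive parts of the
increments of `Y`. -/
noncomputable def posVarOn (Y : ℝ≥0 → ℝ) (s t : ℝ≥0) : ℝ :=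
  sSup {x : ℝ | ∃ (n : ℕ) (τ : ℕ → ℝ≥0), τ 0 = s ∧ τ n = t ∧
    (∀ i < n, τ i ≤ τ (i + 1)) ∧
    x = ∑ i ∈ Finset.range n, max (Y (τ (i + 1)) - Y (τ i)) 0}

/-- The negative variation of `Y : ℝ≥0 → ℝ` on `[s,t]`. -/
noncomputable def negVarOn (Y : ℝ≥0 → ℝ) (s t : ℝ≥0) : ℝ :=
  sSup {x : ℝ | ∃ (n : ℕ) (τ : ℕ → ℝ≥0), τ 0 = s ∧ τ n = t ∧
    (∀ i < n, τ i ≤ τ (i + 1)) ∧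
    x = ∑ i ∈ Finset.range n, max (Y (τ i) - Y (τ (i + 1))) 0}

/-- The supremum of the sums `∑ |B (v i) (v (i + 1))|` over the finite monotone sequences `v`
in `D`. -/
def incrVariation (B : ℝ≥0 → ℝ≥0 → ℝ) (D : Set ℝ≥0) : ℝ≥0∞ :=
  ⨆ p : Σ n : ℕ, {v : Fin (n + 1) → D // Monotone v},
    ∑ i : Fin p.1, ENNReal.ofReal |B (p.2.1 i.castSucc) (p.2.1 i.succ)|

lemma incrVariation_sub (Y : ℝ≥0 → ℝ) (D : Set ℝ≥0) :
    incrVariation (fun a b => Y b - Y a) D = eVariationOn Y D := by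
  refine le_antisymm (iSup_le ?_) (iSup_le ?_)
  · rintro ⟨n, v, hv⟩
    let u : ℕ → ℝ≥0 := fun i => v (Fin.ofNat (n + 1) (min i n))
    have hval (i : ℕ) : (Fin.ofNat (n + 1) (min i n) : ℕ) = min i n :=
      Nat.mod_eq_of_lt (by omega)
    have hu : Monotone u := fun i j hij => hv (by
      rw [Fin.le_def, hval, hval]; omega)
    refine le_trans (le_of_eq ?_) (eVariationOn.sum_le (f := Y) (n := n) hu fun i => (v _).2)
    rw [Finset.sum_range]
    refine Finset.sum_congr rfl fun i _ => ?_
    have h1 : i.castSucc = Fin.ofNat (n + 1) (min (i : ℕ) n) := by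
      ext; rw [hval]; simp
    have h2 : i.succ = Fin.ofNat (n + 1) (min ((i : ℕ) + 1) n) := by
      ext; rw [hval]; simp
    simp only [u, ← h1, ← h2, edist_dist, Real.dist_eq]
  · rintro ⟨n, u, hu, hD⟩
    refine le_iSup_of_le ⟨n, fun i => ⟨u i, hD i⟩, fun i j hij => hu hij⟩ (le_of_eq ?_)
    rw [Finset.sum_range]
    simp [edist_dist, Real.dist_eq]

lemma incrVariation_congr {B B' : ℝ≥0 → ℝ≥0 → ℝ} {D : Set ℝ≥0}
    (h : ∀ a ∈ D, ∀ b ∈ D, a ≤ b → B a b = B' a b) :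
    incrVariation B D = incrVariation B' D := by
  refine iSup_congr fun ⟨n, v, hv⟩ => Finset.sum_congr rfl fun i _ => ?_
  rw [h _ (v _).2 _ (v _).2 (hv (Fin.castSucc_le_succ i))]

lemma measurable_incrVariation {Ω : Type*} [MeasurableSpace Ω] {B : ℝ≥0 → ℝ≥0 → Ω → ℝ}
    {D : Set ℝ≥0} (hD : D.Countable)
    (hB : ∀ a ∈ D, ∀ b ∈ D, a ≤ b → Measurable (B a b)) :
    Measurable fun ω => incrVariation (fun a b => B a b ω) D := by
  have := hD.to_subtype
  refine Measurable.iSup fun ⟨n, v, hv⟩ => Finset.measurable_sum _ fun i _ => ?_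
  exact (hB _ (v _).2 _ (v _).2 (hv (Fin.castSucc_le_succ i))).norm.ennreal_ofReal

/-- A countable set of times, dense in `[t, u]` from the right. -/
def denseTimes (t u : ℝ≥0) : Set ℝ≥0 :=
  Icc t u ∩ range fun p : ℕ × ℕ => min ((p.1 : ℝ≥0) / (p.2 + 1)) u

lemma countable_denseTimes (t u : ℝ≥0) : (denseTimes t u).Countable :=
  (countable_range _).mono inter_subset_right

lemma tendsto_min_ceil_div {x u : ℝ≥0} (hx : x ≤ u) :
    Tendsto (fun n : ℕ => min ((⌈x * (n + 1)⌉₊ : ℝ≥0) / (n + 1)) u) atTop (𝓝[Ici x] x) := by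
  have hle (n : ℕ) : x ≤ (⌈x * (n + 1)⌉₊ : ℝ≥0) / (n + 1) := by
    rw [le_div_iff₀ (by positivity)]
    exact Nat.le_ceil _
  refine tendsto_nhdsWithin_iff.2 ⟨?_, .of_forall fun n => le_min (hle n) hx⟩
  have h : Tendsto (fun n : ℕ => x + 1 / ((n : ℝ≥0) + 1)) atTop (𝓝 x) := by
    simpa using (tendsto_const_nhds (x := x)).add
      (tendsto_one_div_add_atTop_nhds_zero_nat (𝕜 := ℝ≥0))
  refine tendsto_of_tendsto_of_tendsto_of_le_of_le tendsto_const_nhds h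
    (fun n => le_min (hle n) hx) fun n => (min_le_left _ _).trans ?_
  rw [div_le_iff₀ (by positivity), add_mul, one_div_mul_cancel (by positivity)]
  exact (Nat.ceil_lt_add_one zero_le).le

lemma eVariationOn_denseTimes {Y : ℝ≥0 → ℝ} (hY : ∀ t, Tendsto Y (𝓝[Ici t] t) (𝓝 (Y t)))
    (t u : ℝ≥0) : eVariationOn Y (denseTimes t u) = eVariationOn Y (Icc t u) := by
  refine le_antisymm (eVariationOn.mono _ inter_subset_left) (le_of_forall_lt fun v hv => ?_)
  let φ : ℕ → ℝ≥0 → ℝ≥0 := fun n x => min ((⌈x * (n + 1)⌉₊ : ℝ≥0) / (n + 1)) u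
  obtain ⟨n, hn⟩ := (eVariationOn.lowerSemicontinuous_aux (F := fun n => Y ∘ φ n)
    (fun x hx => (hY x).comp (tendsto_min_ceil_div hx.2)) hv).exists
  refine hn.trans_le (eVariationOn.comp_le_of_monotoneOn Y (φ n) ?_ ?_)
  · refine Monotone.monotoneOn (fun x y hxy => ?_) _
    simp only [φ]
    gcongr
  · refine fun x hx => ⟨⟨hx.1.trans (le_min ?_ hx.2), min_le_right _ _⟩,
      (⌈x * (n + 1)⌉₊, n), rfl⟩
    rw [le_div_iff₀ (by positivity)]
    exact Nat.le_ceil _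

lemma incrVariation_denseTimes {Y : ℝ≥0 → ℝ} (hY : ∀ t, Tendsto Y (𝓝[Ici t] t) (𝓝 (Y t)))
    (t u : ℝ≥0) :
    incrVariation (fun a b => Y b - Y a) (denseTimes t u) = eVariationOn Y (Icc t u) := by
  rw [incrVariation_sub, eVariationOn_denseTimes hY]

lemma two_mul_sum_max (Y : ℝ≥0 → ℝ) (τ : ℕ → ℝ≥0) (n : ℕ) :
    2 * ∑ i ∈ Finset.range n, max (Y (τ (i + 1)) - Y (τ i)) 0 =
      ∑ i ∈ Finset.range n, |Y (τ (i + 1)) - Y (τ i)| + (Y (τ n) - Y (τ 0)) := by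
  rw [← Finset.sum_range_sub (fun i => Y (τ i)), ← Finset.sum_add_distrib, Finset.mul_sum]
  refine Finset.sum_congr rfl fun i _ => ?_
  rcases le_total (Y (τ (i + 1)) - Y (τ i)) 0 with h | h
  · rw [max_eq_right h, abs_of_nonpos h]; ring
  · rw [max_eq_left h, abs_of_nonneg h]; ring

lemma sum_edist_eq (Y : ℝ≥0 → ℝ) (τ : ℕ → ℝ≥0) (n : ℕ) :
    ∑ i ∈ Finset.range n, edist (Y (τ (i + 1))) (Y (τ i)) =
      ENNReal.ofReal (∑ i ∈ Finset.range n, |Y (τ (i + 1)) - Y (τ i)|) := by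
  rw [ENNReal.ofReal_sum_of_nonneg fun _ _ => abs_nonneg _]
  simp [edist_dist, Real.dist_eq]

/-- Twice the positive variation is the sum of the total variation and of the increment. -/
lemma posVarOn_eq {Y : ℝ≥0 → ℝ} {s t : ℝ≥0} (hst : s ≤ t)
    (hY : BoundedVariationOn Y (Icc s t)) :
    posVarOn Y s t = ((eVariationOn Y (Icc s t)).toReal + (Y t - Y s)) / 2 := by
  refine IsLUB.csSup_eq ⟨?_, fun b hb => ?_⟩
    ⟨_, 1, fun i => if i = 0 then s else t, by simp, by simp, by simpa using hst, rfl⟩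
  · rintro x ⟨n, τ, h0, hn, hτ, rfl⟩
    have hmono : MonotoneOn τ (Iic n) := by
      intro i _ j hj hij
      induction j, hij using Nat.le_induction with
      | base => exact le_rfl
      | succ k hk ih =>
        have hkn : k < n := hj
        exact (ih hkn.le).trans (hτ k hkn)
    have hmem : ∀ i ≤ n, τ i ∈ Icc s t := fun i hi =>
      ⟨h0 ▸ hmono (by simp) (by simpa using hi) (Nat.zero_le i),
        hn ▸ hmono (by simpa using hi) (by simp) hi⟩
    have h := eVariationOn.sum_le_of_monotoneOn_Iic (f := Y) hmono hmem
    rw [sum_edist_eq] at h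
    have h' := (ENNReal.ofReal_le_iff_le_toReal hY).1 h
    have h2 := two_mul_sum_max Y τ n
    rw [h0, hn] at h2
    linarith
  · suffices h : eVariationOn Y (Icc s t) ≤ ENNReal.ofReal (2 * b - (Y t - Y s)) by
      have hnn : 0 ≤ 2 * b - (Y t - Y s) := by
        have h1 := hb ⟨1, fun i => if i = 0 then s else t, by simp, by simp, by simpa using hst,
          rfl⟩
        simp only [Finset.sum_range_one, zero_add, one_ne_zero, if_false, if_true] at h1
        linarith [le_max_left (Y t - Y s) 0, le_max_right (Y t - Y s) 0]
      have := ENNReal.toReal_mono ENNReal.ofReal_ne_top h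
      rw [ENNReal.toReal_ofReal hnn] at this
      linarith
    refine iSup_le ?_
    rintro ⟨n, u, hu, hst'⟩
    let τ : ℕ → ℝ≥0 := fun i => if i = 0 then s else if i ≤ n + 1 then u (i - 1) else t
    have hτu : ∀ i ≤ n, τ (i + 1) = u i := fun i hi => by simp [τ, hi]
    have hτn : τ (n + 2) = t := by simp [τ]
    have h1 := hb ⟨n + 2, τ, by simp [τ], hτn, fun i hi => ?_, rfl⟩
    · have h2 := two_mul_sum_max Y τ (n + 2)
      rw [hτn, show τ 0 = s by simp [τ]] at h2
      simp only
      rw [sum_edist_eq]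
      refine ENNReal.ofReal_le_ofReal ?_
      have hsplit : ∑ i ∈ Finset.range (n + 2), |Y (τ (i + 1)) - Y (τ i)| =
          ∑ i ∈ Finset.range n, |Y (τ (i + 1 + 1)) - Y (τ (i + 1))| +
            |Y (τ (0 + 1)) - Y (τ 0)| + |Y (τ (n + 1 + 1)) - Y (τ (n + 1))| := by
        rw [Finset.sum_range_succ, Finset.sum_range_succ']
      have h3 : ∑ i ∈ Finset.range n, |Y (u (i + 1)) - Y (u i)| =
          ∑ i ∈ Finset.range n, |Y (τ (i + 1 + 1)) - Y (τ (i + 1))| := by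
        refine Finset.sum_congr rfl fun i hi => ?_
        rw [Finset.mem_range] at hi
        rw [hτu _ hi.le, hτu _ hi]
      have := abs_nonneg (Y (τ (n + 1 + 1)) - Y (τ (n + 1)))
      have := abs_nonneg (Y (τ (0 + 1)) - Y (τ 0))
      linarith
    · rcases Nat.eq_zero_or_pos i with rfl | hi0
      · rw [hτu 0 (Nat.zero_le _)]
        simpa [τ] using (hst' 0).1
      · obtain ⟨j, rfl⟩ := Nat.exists_eq_succ_of_ne_zero hi0.ne'
        rw [Nat.succ_eq_add_one, hτu j (by omega)]
        rcases Nat.lt_or_ge j n with hj | hj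
        · rw [hτu _ hj]
          exact hu (Nat.le_succ j)
        · rw [show j = n by omega, hτn]
          exact (hst' n).2

lemma posVarOn_of_lt (Y : ℝ≥0 → ℝ) {s t : ℝ≥0} (hts : t < s) : posVarOn Y s t = 0 := by
  refine (congrArg sSup (eq_empty_of_forall_notMem ?_)).trans Real.sSup_empty
  rintro x ⟨n, τ, h0, hn, hτ, -⟩
  have h : ∀ i ≤ n, s ≤ τ i := by
    intro i
    induction i with
    | zero => exact fun _ => h0.ge
    | succ k ih => exact fun hk => (ih (by omega)).trans (hτ k (by omega))
  exact hts.not_ge (hn ▸ h n le_rfl)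

lemma posVarOn_neg (Y : ℝ≥0 → ℝ) (s t : ℝ≥0) : posVarOn (fun v => -Y v) s t = negVarOn Y s t := by
  simp only [posVarOn, negVarOn, sub_neg_eq_add, neg_add_eq_sub]

/-- A monotone right-continuous real function is cadlag. -/
lemma Monotone.isCadlag {f : ℝ≥0 → ℝ} (hf : Monotone f)
    (hr : ∀ t, Tendsto f (𝓝[Ici t] t) (𝓝 (f t))) : IsCadlag f :=
  ⟨hr, fun t _ => ⟨_, hf.tendsto_nhdsLT t⟩⟩

lemma Fot_mono {a b : ℝ≥0} (h : a ≤ b) : Fot E a ≤ Fot E b :=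
  biSup_mono fun _ hr => le_trans hr h

lemma Ft_mono {a b : ℝ≥0} (h : a ≤ b) : Ft E a ≤ Ft E b :=
  biInf_mono fun _ hr => lt_of_le_of_lt h hr

lemma pClosure_mono {Ω : Type*} {m0 : MeasurableSpace Ω} {G G' : MeasurableSpace Ω}
    (h : G ≤ G') (μ : @Measure Ω m0) : pClosure G μ ≤ pClosure G' μ :=
  sup_le_sup_right h _

lemma measurableSet_pClosure_of_null {Ω : Type*} {m0 : MeasurableSpace Ω} (G : MeasurableSpace Ω)
    {μ : @Measure Ω m0} {s : Set Ω} (hs : MeasurableSet[m0] s) (h : μ s = 0) :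
    MeasurableSet[pClosure G μ] s :=
  le_sup_right (a := G) _ (MeasurableSpace.measurableSet_generateFrom ⟨hs, h⟩)

variable {E}

lemma IsPathAF.neg {P : ℝ≥0 → PathOmega E → Measure (PathOmega E)}
    {A : ℝ≥0 → ℝ≥0 → PathOmega E → ℝ} {Av : ℝ≥0 → PathOmega E → ℝ≥0 → PathOmega E → ℝ}
    (h : IsPathAF E P A Av) :
    IsPathAF E P (fun t u ω => -A t u ω) (fun s η t ω => -Av s η t ω) where
  meas t u htu := (h.meas t u htu).neg
  cadlag s η ω := ⟨fun t => ((h.cadlag s η ω).1 t).neg, fun t ht =>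
    let ⟨l, hl⟩ := (h.cadlag s η ω).2 t ht
    ⟨-l, hl.neg⟩⟩
  vanish s η v ω hv := by simp [h.vanish s η v ω hv]
  adapted s η v := (h.adapted s η v).neg
  version s η t u hst htu := by
    filter_upwards [h.version s η t u hst htu] with ω hω
    rw [hω]; ring

/-- The positive variation of an additive functional of bounded variation is a nondecreasing
additive functional. -/
lemma exists_posVariation_AF {P : ℝ≥0 → PathOmega E → Measure (PathOmega E)}
    {A : ℝ≥0 → ℝ≥0 → PathOmega E → ℝ} {Av : ℝ≥0 → PathOmega E → ℝ≥0 → PathOmega E → ℝ}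
    (hAF : IsPathAF E P A Av)
    (hBV : ∀ (s : ℝ≥0) (η : PathOmega E),
      ∀ᵐ ω ∂(P s η), BoundedVariationOn (fun t => Av s η t ω) Set.univ) :
    ∃ (PosA : ℝ≥0 → ℝ≥0 → PathOmega E → ℝ)
      (PosAv : ℝ≥0 → PathOmega E → ℝ≥0 → PathOmega E → ℝ),
      IsPathAF E P PosA PosAv ∧
      (∀ (s : ℝ≥0) (η ω : PathOmega E), Monotone fun t => PosAv s η t ω) ∧
      ∀ (s : ℝ≥0) (η : PathOmega E), ∀ᵐ ω ∂(P s η), ∀ t : ℝ≥0,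
        PosAv s η t ω = posVarOn (fun v => Av s η v ω) s t := by
  classical
  let N : ℝ≥0 → PathOmega E → Set (PathOmega E) := fun s η =>
    toMeasurable (P s η) {ω | ¬ BoundedVariationOn (fun t => Av s η t ω) Set.univ}
  have hNm (s η) : MeasurableSet (N s η) := measurableSet_toMeasurable _ _
  have hN0 (s η) : P s η (N s η) = 0 := (measure_toMeasurable _).trans (hBV s η)
  have hNae (s η) : ∀ᵐ ω ∂(P s η), ω ∉ N s η := measure_eq_zero_iff_ae_notMem.1 (hN0 s η)
  have hNbv {s η ω} (h : ω ∉ N s η) : BoundedVariationOn (fun t => Av s η t ω) Set.univ := by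
    by_contra hc
    exact h (subset_toMeasurable _ _ hc)
  let PosA : ℝ≥0 → ℝ≥0 → PathOmega E → ℝ := fun t u ω =>
    ((incrVariation (fun a b => A a b ω) (denseTimes t u)).toReal + A t u ω) / 2
  let PosAv : ℝ≥0 → PathOmega E → ℝ≥0 → PathOmega E → ℝ := fun s η t ω =>
    if ω ∈ N s η then 0
    else (variationOnFromTo (fun v => Av s η v ω) univ s t + Av s η t ω) / 2
  have hmono (s η ω) : Monotone fun t => PosAv s η t ω := by
    intro a b hab
    by_cases h : ω ∈ N s η
    · simp [PosAv, h]
    · have := variationOnFromTo.add_self_monotoneOn (hNbv h).locallyBoundedVariationOn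
        (mem_univ s) (mem_univ a) (mem_univ b) hab
      simp only [PosAv, h, if_false, Pi.add_apply] at this ⊢
      linarith
  have hvanish (s η v ω) (hv : v ≤ s) : PosAv s η v ω = 0 := by
    have h0 : variationOnFromTo (fun v => Av s η v ω) univ s v = 0 := by
      rw [variationOnFromTo.eq_of_ge _ _ hv, eVariationOn.constant_on]
      · simp
      · rintro _ ⟨x, hx, rfl⟩ _ ⟨y, hy, rfl⟩
        simp [hAF.vanish s η x ω hx.2.2, hAF.vanish s η y ω hy.2.2]
    simp [PosAv, h0, hAF.vanish s η v ω hv]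
  refine ⟨PosA, PosAv, ⟨fun t u htu => ?_, fun s η ω => ?_, hvanish, fun s η v => ?_,
    fun s η t u hst htu => ?_⟩, hmono, fun s η => ?_⟩
  · refine Measurable.div_const (Measurable.add (Measurable.ennreal_toReal ?_)
      (hAF.meas t u htu)) 2
    exact @measurable_incrVariation _ (Fot E u) _ _ (countable_denseTimes t u)
      fun a _ b hb hab => (hAF.meas a b hab).mono (Fot_mono E hb.1.2) le_rfl
  · refine (hmono s η ω).isCadlag fun t => ?_
    by_cases h : ω ∈ N s η
    · simp [PosAv, h]
    · have hr := (hAF.cadlag s η ω).1 t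
      have := ((hNbv h).continuousWithinAt_variationOnFromTo_Ici (a := s) hr).tendsto
      simpa only [PosAv, h, if_false] using (this.add hr).div_const 2
  · rcases le_total v s with hv | hv
    · have : PosAv s η v = fun _ => 0 := funext fun ω => hvanish s η v ω hv
      rw [this]
      exact measurable_const
    · have hrw : PosAv s η v = fun ω => if ω ∈ N s η then 0 else
          ((incrVariation (fun a b => Av s η b ω - Av s η a ω) (denseTimes s v)).toReal +
            Av s η v ω) / 2 := by
        ext ω
        simp only [PosAv, variationOnFromTo.eq_of_le _ _ hv, univ_inter,
          incrVariation_denseTimes (hAF.cadlag s η ω).1]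
      rw [hrw]
      refine Measurable.ite (measurableSet_pClosure_of_null _ (hNm s η) (hN0 s η))
        measurable_const (Measurable.div_const (Measurable.add (Measurable.ennreal_toReal ?_)
          (hAF.adapted s η v)) 2)
      have had {a : ℝ≥0} (ha : a ≤ v) : Measurable[pClosure (Ft E v) (P s η)] (Av s η a) :=
        (hAF.adapted s η a).mono (pClosure_mono (Ft_mono E ha) _) le_rfl
      exact @measurable_incrVariation _ (pClosure (Ft E v) (P s η))
        (fun a b ω => Av s η b ω - Av s η a ω) _ (countable_denseTimes s v)
        fun a ha b hb _ => (had hb.1.2).sub (had ha.1.2)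
  · have hD : ∀ᵐ ω ∂(P s η), ∀ a ∈ denseTimes t u, ∀ b ∈ denseTimes t u, a ≤ b →
        A a b ω = Av s η b ω - Av s η a ω := by
      refine (ae_ball_iff (countable_denseTimes t u)).2 fun a ha =>
        (ae_ball_iff (countable_denseTimes t u)).2 fun b _ => ?_
      by_cases hab : a ≤ b
      · filter_upwards [hAF.version s η a b (hst.trans ha.1.1) hab] with ω hω _ using hω
      · exact .of_forall fun ω h => absurd h hab
    filter_upwards [hD, hNae s η, hAF.version s η t u hst htu] with ω hω hN htuω
    have hvar := variationOnFromTo.sub_right (hNbv hN).locallyBoundedVariationOn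
      (mem_univ s) (mem_univ u) (mem_univ t)
    rw [variationOnFromTo.eq_of_le _ _ htu, univ_inter,
      ← incrVariation_denseTimes (hAF.cadlag s η ω).1, ← incrVariation_congr hω] at hvar
    simp only [PosA, PosAv, hN, if_false, ← hvar, htuω]
    ring
  · filter_upwards [hNae s η] with ω hN t
    rcases lt_or_ge t s with hts | hst
    · rw [hvanish s η t ω hts.le, posVarOn_of_lt _ hts]
    · rw [posVarOn_eq hst ((hNbv hN).mono (subset_univ _)), hAF.vanish s η s ω le_rfl]
      simp only [PosAv, hN, if_false, variationOnFromTo.eq_of_le _ _ hst, univ_inter, sub_zero]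

variable (E)

/-- Proposition 3.12: for a path-dependent AF `A` of bounded
variation with `L¹` terminal value there exist nondecreasing path-dependent AFs
`Pos(A)` and `Neg(A)` whose cadlag versions under every `ℙ^{s,η}` are the
positive and negative variations of the cadlag version `A^{s,η}`. -/
theorem exists_posNeg_variation_AF [PolishSpace E] [BorelSpace E]
    (P : ℝ≥0 → PathOmega E → Measure (PathOmega E))
    (hP : IsPathCanonicalClass P) (hH : HypH E P) (hprog : ProgressiveClass E P)
    (A : ℝ≥0 → ℝ≥0 → PathOmega E → ℝ)
    (Av : ℝ≥0 → PathOmega E → ℝ≥0 → PathOmega E → ℝ)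
    (hAF : IsPathAF E P A Av)
    (hBV : ∀ (s : ℝ≥0) (η : PathOmega E),
      ∀ᵐ ω ∂(P s η), BoundedVariationOn (fun t => Av s η t ω) Set.univ)
    (hL1 : ∀ (s : ℝ≥0) (η : PathOmega E), ∃ ξ : PathOmega E → ℝ,
      Integrable ξ (P s η) ∧
        ∀ᵐ ω ∂(P s η), Tendsto (fun t => Av s η t ω) atTop (𝓝 (ξ ω))) :
    ∃ (PosA NegA : ℝ≥0 → ℝ≥0 → PathOmega E → ℝ)
      (PosAv NegAv : ℝ≥0 → PathOmega E → ℝ≥0 → PathOmega E → ℝ),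
      IsPathAF E P PosA PosAv ∧ IsPathAF E P NegA NegAv ∧
      (∀ (s : ℝ≥0) (η ω : PathOmega E), Monotone fun t => PosAv s η t ω) ∧
      (∀ (s : ℝ≥0) (η ω : PathOmega E), Monotone fun t => NegAv s η t ω) ∧
      ∀ (s : ℝ≥0) (η : PathOmega E),
        ∀ᵐ ω ∂(P s η), ∀ t : ℝ≥0,
          PosAv s η t ω = posVarOn (fun v => Av s η v ω) s t ∧
          NegAv s η t ω = negVarOn (fun v => Av s η v ω) s t := by
  obtain ⟨PosA, PosAv, hPos, hPosMono, hPosEq⟩ := exists_posVariation_AF hAF hBV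
  obtain ⟨NegA, NegAv, hNeg, hNegMono, hNegEq⟩ := exists_posVariation_AF hAF.neg
    fun s η => (hBV s η).mono fun ω hω => by
      simpa [Function.comp_def] using
        (LipschitzWith.id.neg (α := ℝ)).comp_boundedVariationOn hω
  refine ⟨PosA, NegA, PosAv, NegAv, hPos, hNeg, hPosMono, hNegMono, fun s η => ?_⟩
  filter_upwards [hPosEq s η, hNegEq s η] with ω h₁ h₂ t
  exact ⟨h₁ t, (h₂ t).trans (posVarOn_neg _ s t)⟩
end
end
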